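/- For every natural number k ≥ 1, the following identity holds in ℤ: 2·(coefficient of X^k in X + Y) + ∑_{n=2}^{k} (−1)^{n−1}·(coefficient of X^k in X^n + Y^n) = 0. (This is the coefficientwise form, after applying the injective complexification map, of the infinite relation 2[1,0] + ∑_{n≥2} (−1)^{n−1}[n,0] = 0 among the generators 𝒢₂ of KO⁰(BT¹) in equation (4.5); note that for n > k the power series X^n + Y^n has vanishing coefficient of X^k, so the sum is finite.) -/

import Mathlib

/-- The power series `Y = −X + X² − X³ + ⋯ ∈ ℤ⟦X⟧`, the conjugate `x̄ = −x/(1+x)`. -/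
noncomputable def Y : PowerSeries ℤ :=
  PowerSeries.mk fun n => if n = 0 then 0 else (-1) ^ n

/-- Substitution of `Y` (which has zero constant term) into a formal power series:
the coefficient of `X^n` in `f(Y)` is `∑_{k ≤ n} (coeff k f) · coeff n (Y^k)`,
which is the standard substitution formula (the sum is finite since `Y` has order `≥ 1`). -/
noncomputable def substY (f : PowerSeries ℤ) : PowerSeries ℤ :=
  PowerSeries.mk fun n =>
    ∑ k ∈ Finset.range (n + 1), PowerSeries.coeff (R := ℤ) k f * PowerSeries.coeff (R := ℤ) n (Y ^ k)

theorem one_add_Y_mul_one_add_X : (1 + Y) * (1 + PowerSeries.X) = 1 := by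
  ext n
  rw [mul_add, mul_one, map_add]
  rcases n with _ | n
  · simp [Y]
  · rw [PowerSeries.coeff_succ_mul_X]
    rcases n with _ | n <;> simp [Y, PowerSeries.coeff_one, pow_succ]

theorem X_dvd_Y : PowerSeries.X ∣ Y := by
  rw [PowerSeries.X_dvd_iff, ← PowerSeries.coeff_zero_eq_constantCoeff_apply]
  simp [Y]

/-- The truncated alternating geometric series, with `w` inverse to `1 + z`. -/
theorem add_sum_Icc_neg_one_pow_mul_pow {R : Type*} [CommRing R] {w z : R}
    (h : w * (1 + z) = 1) {k : ℕ} (hk : 1 ≤ k) :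
    z + ∑ n ∈ Finset.Icc 2 k, (-1) ^ (n - 1) * z ^ n = w * (z + (-z) ^ (k + 1)) := by
  induction k, hk using Nat.le_induction with
  | base =>
    simp only [Finset.Icc_eq_empty_of_lt one_lt_two, Finset.sum_empty]
    linear_combination (-z) * h
  | succ m hm ih =>
    rw [Finset.sum_Icc_succ_top (by lia), ← add_assoc, ih, Nat.add_sub_cancel, neg_pow z (m + 1),
      neg_pow z (m + 1 + 1)]
    linear_combination (-(-1) ^ m * z ^ (m + 1)) * h

/-- Modulo `X ^ (k + 1)`, the alternating geometric series sums to `w * z = 1 - w`. -/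
theorem coeff_add_sum_Icc_neg_one_pow_mul_pow {R : Type*} [CommRing R] {w z : PowerSeries R}
    (h : w * (1 + z) = 1) (hz : PowerSeries.X ∣ z) {k : ℕ} (hk : 1 ≤ k) :
    PowerSeries.coeff k z +
        ∑ n ∈ Finset.Icc 2 k, (-1 : R) ^ (n - 1) * PowerSeries.coeff k (z ^ n) =
      PowerSeries.coeff k (w * z) := by
  have hdvd : PowerSeries.X ^ (k + 1) ∣ w * (-z) ^ (k + 1) :=
    (pow_dvd_pow_of_dvd (hz.neg_right) _).mul_left w
  have key := congrArg (PowerSeries.coeff k) (add_sum_Icc_neg_one_pow_mul_pow h hk)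
  rw [mul_add, map_add, map_add, PowerSeries.X_pow_dvd_iff.mp hdvd k k.lt_succ_self, add_zero,
    map_sum] at key
  rw [← key]
  congr 1
  refine Finset.sum_congr rfl fun n _ => ?_
  rw [← PowerSeries.coeff_C_mul]
  simp

/-- The coefficientwise form of the infinite relation (4.5):
`2[1,0] + ∑_{n≥2} (−1)^{n−1}[n,0] = 0` in `KO⁰(BT¹)`, after complexification. -/
theorem infinite_relation_coeff (k : ℕ) (hk : 1 ≤ k) :
    2 * PowerSeries.coeff (R := ℤ) k (PowerSeries.X + Y) +
        ∑ n ∈ Finset.Icc 2 k,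
          (-1 : ℤ) ^ (n - 1) * PowerSeries.coeff (R := ℤ) k (PowerSeries.X ^ n + Y ^ n) = 0 := by
  have hX := coeff_add_sum_Icc_neg_one_pow_mul_pow one_add_Y_mul_one_add_X dvd_rfl hk
  have hY := coeff_add_sum_Icc_neg_one_pow_mul_pow
    ((mul_comm _ _).trans one_add_Y_mul_one_add_X) X_dvd_Y hk
  have hXY : (1 + Y) * PowerSeries.X = -Y := by
    linear_combination one_add_Y_mul_one_add_X
  have hYX : (1 + PowerSeries.X) * Y = -PowerSeries.X := by
    linear_combination one_add_Y_mul_one_add_X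
  rw [hXY, map_neg] at hX
  rw [hYX, map_neg] at hY
  simp only [map_add, mul_add, Finset.sum_add_distrib]
  linear_combination hX + hY
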